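/- arXiv:math/0608474 — 3 statements merged into one kernel-verified Lean document; each statement's English description precedes it below -/
import Mathlib

section
/- If 𝒢 = {G_n}_{n=1}^∞ is a large girth graph sequence, then e(𝒢) = c(𝒢). -/
open Filter Function Set
open scoped Classical TensorProduct Pointwise symmDiff

universe u

namespace GraphSeqPaper

/-- The space of `K`-valued antisymmetric functions supported on the (oriented) edges of `G`:
the `K`-vector space spanned by the edges with the convention `(x,y) = -(y,x)`. -/
def edgeSpace (K : Type*) [Field K] {V : Type u} (G : SimpleGraph V) :
    Submodule K (V → V → K) where
  carrier := {f | (∀ x y, ¬ G.Adj x y → f x y = 0) ∧ ∀ x y, f x y = - f y x}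
  add_mem' := by
    rintro f g ⟨hf1, hf2⟩ ⟨hg1, hg2⟩
    refine ⟨fun x y h => ?_, fun x y => ?_⟩
    · simp only [Pi.add_apply, hf1 x y h, hg1 x y h, add_zero]
    · simp only [Pi.add_apply, hf2 x y, hg2 x y]; ring
  zero_mem' := ⟨fun x y _ => rfl, fun x y => by simp⟩
  smul_mem' := by
    rintro c f ⟨hf1, hf2⟩
    refine ⟨fun x y h => ?_, fun x y => ?_⟩
    · simp only [Pi.smul_apply, hf1 x y h, smul_zero]
    · simp only [Pi.smul_apply, hf2 x y, smul_neg]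

lemma edgeSpace_mono (K : Type*) [Field K] {V : Type u} {H G : SimpleGraph V}
    (h : H ≤ G) : edgeSpace K H ≤ edgeSpace K G :=
  fun f hf => ⟨fun x y hxy => hf.1 x y fun ha => hxy (h ha), hf.2⟩

/-- The basis vector of `ε_K` associated to the oriented edge `(x,y)`. -/
noncomputable def edgeVec (K : Type*) [Field K] {V : Type u} (x y : V) : V → V → K :=
  fun a b => if a = x ∧ b = y then (1 : K) else if a = y ∧ b = x then (-1 : K) else 0

/-- The vector of a walk `(x₀, x₁, …, x_l)`, namely `Σ_{i} (x_i, x_{i+1})`. -/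
noncomputable def walkVec (K : Type*) [Field K] {V : Type u} {G : SimpleGraph V} :
    ∀ {x y : V}, G.Walk x y → (V → V → K)
  | _, _, SimpleGraph.Walk.nil => 0
  | _, _, @SimpleGraph.Walk.cons _ _ a b _ _ p => edgeVec K a b + walkVec K p

/-- `C^q_K(G)`: the subspace of `ε_K(G)` spanned by the vectors of cycles of length at most
`q`. -/
noncomputable def cycleSpace (K : Type*) [Field K] {V : Type u} (G : SimpleGraph V) (q : ℕ) :
    Submodule K (V → V → K) :=
  Submodule.span K
    {f | ∃ (x : V) (c : G.Walk x x), c.IsCycle ∧ c.length ≤ q ∧ f = walkVec K c}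

/-- A graph sequence: finite simple graphs, of uniformly bounded vertex degrees, whose number
of vertices tends to infinity. -/
def IsGraphSeq (V : ℕ → Type u) (G : ∀ n, SimpleGraph (V n)) : Prop :=
  (∀ n, Finite (V n)) ∧
    (∃ D : ℕ, ∀ n (x : V n), ((G n).neighborSet x).ncard ≤ D) ∧
      Tendsto (fun n => Nat.card (V n)) atTop atTop

/-- `ℋ ≺ 𝒢`: there is an integer `L > 0` with `d_{G_n}(x,y) ≤ L · d_{H_n}(x,y)` for all `n`
and all vertices `x, y`. -/
def Prec {V : ℕ → Type u} (H G : ∀ n, SimpleGraph (V n)) : Prop :=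
  ∃ L : ℕ, 0 < L ∧ ∀ n (x y : V n), (G n).dist x y ≤ L * (H n).dist x y

/-- `𝒢 ≃ ℋ`: `ℋ ≺ 𝒢` and `𝒢 ≺ ℋ`. -/
def GEquiv {V : ℕ → Type u} (G H : ∀ n, SimpleGraph (V n)) : Prop :=
  Prec H G ∧ Prec G H

/-- The edge number `e(𝒢) = liminf |E(G_n)|/|V(G_n)|`. -/
noncomputable def edgeNum {V : ℕ → Type u} (G : ∀ n, SimpleGraph (V n)) : ℝ :=
  liminf (fun n => ((G n).edgeSet.ncard : ℝ) / (Nat.card (V n) : ℝ)) atTop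

/-- The cost `c(𝒢) = inf { e(ℋ) : ℋ ≃ 𝒢 }`. -/
noncomputable def cost {V : ℕ → Type u} (G : ∀ n, SimpleGraph (V n)) : ℝ :=
  sInf {r : ℝ | ∃ H : ∀ n, SimpleGraph (V n), IsGraphSeq V H ∧ GEquiv G H ∧ r = edgeNum H}

/-- `s^q_K(𝒢) = liminf (|E(G_n)| - dim_K C^q_K(G_n))/|V(G_n)| - 1`. -/
noncomputable def sInv (K : Type*) [Field K] {V : ℕ → Type u}
    (G : ∀ n, SimpleGraph (V n)) (q : ℕ) : ℝ :=
  liminf (fun n =>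
    (((G n).edgeSet.ncard : ℝ) - (Module.finrank K (cycleSpace K (G n) q) : ℝ)) /
      (Nat.card (V n) : ℝ)) atTop - 1

/-- `β_K(𝒢) = inf_q s^q_K(𝒢)`. -/
noncomputable def beta (K : Type*) [Field K] {V : ℕ → Type u}
    (G : ∀ n, SimpleGraph (V n)) : ℝ :=
  ⨅ q : ℕ, sInv K G q

/-- A large girth sequence: for every `k ≥ 1`, all but finitely many `G_n` contain no cycle of
length at most `k`. -/
def LargeGirth {V : ℕ → Type u} (G : ∀ n, SimpleGraph (V n)) : Prop :=
  ∀ k : ℕ, 1 ≤ k → ∃ N : ℕ, ∀ n, N ≤ n →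
    ∀ (x : V n) (c : (G n).Walk x x), c.IsCycle → k < c.length

/-- The set of edges of `G` whose two endpoints lie in different classes of the partition given
by the fibres of `P`. -/
def crossEdges {V : Type u} (G : SimpleGraph V) (P : V → ℕ) : Set (Sym2 V) :=
  {e | e ∈ G.edgeSet ∧ ∃ x ∈ e, ∃ y ∈ e, P x ≠ P y}

/-- Hyperfiniteness of a graph sequence. -/
def Hyperfinite {V : ℕ → Type u} (G : ∀ n, SimpleGraph (V n)) : Prop :=
  ∀ ε : ℝ, 0 < ε → ∃ Kb : ℕ, ∃ P : ∀ n, V n → ℕ,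
    (∀ n i, {x : V n | P n x = i}.ncard ≤ Kb) ∧
      liminf (fun n => ((crossEdges (G n) (P n)).ncard : ℝ) / (Nat.card (V n) : ℝ)) atTop ≤ ε

/-- The Cayley graph of a group with respect to a (symmetric) set `T`:
`x ~ y` iff `x ≠ y` and `y x⁻¹ ∈ T` (or `x y⁻¹ ∈ T`). -/
def cayley (Q : Type u) [Group Q] (T : Set Q) : SimpleGraph Q :=
  SimpleGraph.fromRel (fun x y => y * x⁻¹ ∈ T)

/-- The Cayley graph of the quotient `Γ ⧸ N` with respect to the image of `S`. -/
def cayleyQuot {Γ : Type u} [Group Γ] (N : Subgroup Γ) (hN : N.Normal) (S : Set Γ) :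
    SimpleGraph (Γ ⧸ N) :=
  haveI := hN
  cayley (Γ ⧸ N) ((fun g => (QuotientGroup.mk g : Γ ⧸ N)) '' S)

/-- The minimal number of generators of a group. -/
noncomputable def minGens (Λ : Type u) [Group Λ] : ℕ :=
  sInf {d : ℕ | ∃ T : Set Λ, T.Finite ∧ T.ncard = d ∧ Subgroup.closure T = ⊤}

/-- A group is finitely presented. -/
def FinitelyPresentedGroup (Γ : Type u) [Group Γ] : Prop :=
  ∃ (n : ℕ) (f : FreeGroup (Fin n) →* Γ) (R : Set (FreeGroup (Fin n))),
    Surjective f ∧ R.Finite ∧ f.ker = Subgroup.normalClosure R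

/-- Amenability via the Følner condition. -/
def IsAmenableFolner (Γ : Type u) [Group Γ] : Prop :=
  ∀ F : Set Γ, F.Finite → ∀ ε : ℝ, 0 < ε →
    ∃ A : Set Γ, A.Finite ∧ A.Nonempty ∧
      ∀ s ∈ F, (((s • A) ∆ A).ncard : ℝ) ≤ ε * A.ncard

/-- The set of edges of `G` joining `F` to its complement. -/
def edgeBoundary {V : Type u} (G : SimpleGraph V) (F : Set V) : Set (Sym2 V) :=
  {e | e ∈ G.edgeSet ∧ ∃ x ∈ e, ∃ y ∈ e, x ∈ F ∧ y ∉ F}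

/-- In a graph without short cycles, the edges of a short walk form an acyclic graph. -/
lemma isAcyclic_fromEdgeSet_edges {V : Type u} {G : SimpleGraph V} {k : ℕ}
    (hgirth : ∀ (x : V) (c : G.Walk x x), c.IsCycle → k < c.length)
    {x y : V} (w : G.Walk x y) (hw : w.length ≤ k) :
    (SimpleGraph.fromEdgeSet {e | e ∈ w.edges}).IsAcyclic := by
  intro v c hc
  have hle : SimpleGraph.fromEdgeSet {e | e ∈ w.edges} ≤ G := by
    intro a b hab
    rw [SimpleGraph.fromEdgeSet_adj] at hab
    exact w.adj_of_mem_edges hab.1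
  have h1 := hgirth v (c.mapLe hle) (hc.mapLe hle)
  have h2 : c.edges ⊆ w.edges := by
    intro e he
    have := c.edges_subset_edgeSet he
    rw [SimpleGraph.edgeSet_fromEdgeSet] at this
    exact this.1
  have h3 : c.edges.length ≤ w.edges.length :=
    (hc.isCircuit.isTrail.edges_nodup.subperm h2).length_le
  simp only [SimpleGraph.Walk.length_edges, SimpleGraph.Walk.length_map,
    SimpleGraph.Walk.mapLe] at h1 h3
  omega

/-- Whether a walk crosses a bridge an even number of times only depends on the sides of the
bridge on which its endpoints lie. -/
lemma count_edges_eq_of_isBridge {V : Type u} {T : SimpleGraph V} {a b : V}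
    (hb : T.IsBridge s(a, b)) {x y : V} (w : T.Walk x y) :
    (w.edges.count s(a, b) : ZMod 2) =
      (if (T.deleteEdges {s(a, b)}).Reachable a x then 1 else 0) +
        (if (T.deleteEdges {s(a, b)}).Reachable a y then 1 else 0) := by
  have hnr : ¬ (T.deleteEdges {s(a, b)}).Reachable a b := by
    simpa [SimpleGraph.isBridge_iff, SimpleGraph.deleteEdges] using hb
  induction w with
  | nil => simp [CharTwo.add_self_eq_zero]
  | @cons u v z h p ih =>
    rw [SimpleGraph.Walk.edges_cons, List.count_cons, Nat.cast_add, ih]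
    by_cases he : s(u, v) = s(a, b)
    · simp only [he, beq_self_eq_true, if_true]
      rcases Sym2.eq_iff.1 he with ⟨rfl, rfl⟩ | ⟨rfl, rfl⟩
      · simp [hnr, add_comm]
      · simp only [SimpleGraph.Reachable.refl, if_true, hnr, if_false]
        rw [add_right_comm]
        simp [CharTwo.add_self_eq_zero]
    · have hadj : (T.deleteEdges {s(a, b)}).Adj u v := by
        simp [SimpleGraph.deleteEdges_adj, h, he]
      have hiff : (T.deleteEdges {s(a, b)}).Reachable a u ↔
          (T.deleteEdges {s(a, b)}).Reachable a v :=
        ⟨fun hr => hr.trans hadj.reachable, fun hr => hr.trans hadj.symm.reachable⟩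
      simp [he, hiff]

/-- In a graph without short cycles, a short closed walk crosses each edge an even number of
times. -/
lemma count_edges_closed_eq_zero {V : Type u} {G : SimpleGraph V} {k : ℕ}
    (hgirth : ∀ (x : V) (c : G.Walk x x), c.IsCycle → k < c.length)
    {x : V} (w : G.Walk x x) (hw : w.length ≤ k) (f : Sym2 V) :
    (w.edges.count f : ZMod 2) = 0 := by
  by_cases hf : f ∈ w.edges
  swap
  · simp [List.count_eq_zero_of_not_mem hf]
  have hac := isAcyclic_fromEdgeSet_edges hgirth w hw
  have hmem : ∀ e ∈ w.edges, e ∈ (SimpleGraph.fromEdgeSet {e | e ∈ w.edges}).edgeSet := by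
    intro e he
    rw [SimpleGraph.edgeSet_fromEdgeSet]
    exact ⟨he, G.not_isDiag_of_mem_edgeSet (w.edges_subset_edgeSet he)⟩
  have hbr := SimpleGraph.isAcyclic_iff_forall_isBridge.1 hac (hmem f hf)
  induction f using Sym2.ind with
  | _ a b =>
    have := count_edges_eq_of_isBridge hbr (w.transfer _ hmem)
    rwa [SimpleGraph.Walk.edges_transfer, CharTwo.add_self_eq_zero] at this

/-- Replacing every edge of a walk in `H` by a walk of length at most `L` in `G` gives a walk in
`G` whose edge counts are linear in those of the original walk. -/
lemma exists_walk_count_eq_sum {V : Type u} [Fintype V] {G H : SimpleGraph V} {L : ℕ}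
    (c : Sym2 V → Sym2 V → ZMod 2)
    (hc : ∀ x y, H.Adj x y → ∃ r : G.Walk x y, r.length ≤ L ∧
      ∀ f, (r.edges.count f : ZMod 2) = c s(x, y) f)
    {x y : V} (p : H.Walk x y) :
    ∃ q : G.Walk x y, q.length ≤ L * p.length ∧
      ∀ f, (q.edges.count f : ZMod 2) =
        ∑ e : H.edgeSet, (p.edges.count (e : Sym2 V) : ZMod 2) * c e f := by
  induction p with
  | nil => exact ⟨SimpleGraph.Walk.nil, by simp, by simp⟩
  | @cons u v z h p ih =>
    obtain ⟨q, hq, hqc⟩ := ih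
    obtain ⟨r, hr, hrc⟩ := hc u v h
    refine ⟨r.append q, ?_, fun f => ?_⟩
    · rw [SimpleGraph.Walk.length_append, SimpleGraph.Walk.length_cons, mul_add]
      omega
    · rw [SimpleGraph.Walk.edges_append, List.count_append, Nat.cast_add, hqc, hrc]
      simp only [SimpleGraph.Walk.edges_cons, List.count_cons, Nat.cast_add, add_mul,
        Finset.sum_add_distrib]
      rw [add_comm]
      congr 1
      rw [Finset.sum_eq_single (⟨s(u, v), h⟩ : H.edgeSet)]
      · simp
      · intro e _ he
        have : s(u, v) ≠ (e : Sym2 V) := fun h' => he (Subtype.ext h'.symm)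
        simp [this]
      · simp

/-- Walks joining the endpoints of edges can be chosen independently of the orientation, as far
as edge counts are concerned. -/
lemma exists_edge_count {V : Type u} {G H : SimpleGraph V} {L : ℕ}
    (h : ∀ x y, H.Adj x y → ∃ r : G.Walk x y, r.length ≤ L) :
    ∃ c : Sym2 V → Sym2 V → ZMod 2, ∀ x y, H.Adj x y →
      ∃ r : G.Walk x y, r.length ≤ L ∧ ∀ f, (r.edges.count f : ZMod 2) = c s(x, y) f := by
  have key : ∀ e : Sym2 V, ∃ g : Sym2 V → ZMod 2, ∀ x y, e = s(x, y) → H.Adj x y →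
      ∃ r : G.Walk x y, r.length ≤ L ∧ ∀ f, (r.edges.count f : ZMod 2) = g f := by
    intro e
    induction e using Sym2.ind with
    | _ a b =>
      by_cases hab : H.Adj a b
      · obtain ⟨r, hr⟩ := h a b hab
        refine ⟨fun f => (r.edges.count f : ZMod 2), fun x y hxy _ => ?_⟩
        rcases Sym2.eq_iff.1 hxy with ⟨rfl, rfl⟩ | ⟨rfl, rfl⟩
        · exact ⟨r, hr, fun _ => rfl⟩
        · exact ⟨r.reverse, by simpa using hr, fun f => by simp⟩
      · refine ⟨0, fun x y hxy hadj => absurd ?_ hab⟩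
        rw [← SimpleGraph.mem_edgeSet, hxy]
        exact hadj
  choose c hc using key
  exact ⟨c, fun x y hxy => hc _ x y rfl hxy⟩

/-- A graph of large girth has no more edges than a graph that is bi-Lipschitz equivalent to
it. -/
lemma ncard_edgeSet_le {V : Type u} [Finite V] {G H : SimpleGraph V} {L M : ℕ}
    (hHG : ∀ x y, H.Adj x y → ∃ r : G.Walk x y, r.length ≤ L)
    (hGH : ∀ x y, G.Adj x y → ∃ r : H.Walk x y, r.length ≤ M)
    (hgirth : ∀ (x : V) (c : G.Walk x x), c.IsCycle → L * M + 1 < c.length) :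
    G.edgeSet.ncard ≤ H.edgeSet.ncard := by
  have := Fintype.ofFinite V
  obtain ⟨c, hc⟩ := exists_edge_count hHG
  obtain ⟨d, hd⟩ := exists_edge_count hGH
  let φ : (H.edgeSet → ZMod 2) →ₗ[ZMod 2] (Sym2 V → ZMod 2) :=
    { toFun := fun g f => ∑ e : H.edgeSet, g e * c e f
      map_add' := fun g g' => by
        ext f
        simp [add_mul, Finset.sum_add_distrib]
      map_smul' := fun a g => by
        ext f
        simp [Finset.mul_sum, mul_assoc] }
  let v : G.edgeSet → (H.edgeSet → ZMod 2) := fun e e' => d e e'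
  have hφ : ∀ e : G.edgeSet, φ (v e) = Pi.single (e : Sym2 V) 1 := by
    rintro ⟨e, he⟩
    induction e using Sym2.ind with
    | _ a b =>
      have hab : G.Adj a b := he
      obtain ⟨p, hp, hpd⟩ := hd a b hab
      obtain ⟨q, hq, hqc⟩ := exists_walk_count_eq_sum c hc p
      ext f
      have h0 := count_edges_closed_eq_zero hgirth (SimpleGraph.Walk.cons hab.symm q) (by
        rw [SimpleGraph.Walk.length_cons]
        have := Nat.mul_le_mul_left L hp
        omega) f
      rw [SimpleGraph.Walk.edges_cons, List.count_cons, Nat.cast_add, hqc,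
        CharTwo.add_eq_zero] at h0
      change ∑ e : H.edgeSet, d s(a, b) e * c e f = _
      simp only [hpd] at h0
      rw [h0, Sym2.eq_swap]
      by_cases hf : f = s(a, b)
      · simp [hf]
      · simp [hf, Ne.symm hf]
  have hli : LinearIndependent (ZMod 2) v := by
    refine LinearIndependent.of_comp φ ?_
    have : φ ∘ v = (fun f : Sym2 V => Pi.single f (1 : ZMod 2)) ∘ Subtype.val := funext hφ
    rw [this]
    exact (Pi.linearIndependent_single_one (Sym2 V) (ZMod 2)).comp _ Subtype.val_injective
  have := hli.fintype_card_le_finrank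
  rw [Module.finrank_fintype_fun_eq_card] at this
  rwa [← Nat.card_coe_set_eq, ← Nat.card_coe_set_eq, Nat.card_eq_fintype_card,
    Nat.card_eq_fintype_card]

/-- If distances in both graphs control each other, then edges of `H` are joined by short walks
in `G`. -/
lemma exists_walk_of_dist_le {V : Type u} {G H : SimpleGraph V} {L M : ℕ}
    (hL : ∀ x y, G.dist x y ≤ L * H.dist x y) (hM : ∀ x y, H.dist x y ≤ M * G.dist x y)
    (x y : V) (hxy : H.Adj x y) : ∃ r : G.Walk x y, r.length ≤ L := by
  have h1 : H.dist x y = 1 := SimpleGraph.dist_eq_one_iff_adj.2 hxy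
  have hr : G.Reachable x y := by
    by_contra hn
    have := hM x y
    rw [SimpleGraph.dist_eq_zero_of_not_reachable hn, h1] at this
    omega
  obtain ⟨r, hr⟩ := hr.exists_walk_length_eq_dist
  refine ⟨r, ?_⟩
  have := hL x y
  rw [h1] at this
  omega

lemma ncard_edgeSet_div_le {V : Type u} [Finite V] {G : SimpleGraph V} {D : ℕ}
    (hD : ∀ x, (G.neighborSet x).ncard ≤ D) :
    (G.edgeSet.ncard : ℝ) / (Nat.card V : ℝ) ≤ D := by
  have := Fintype.ofFinite V
  have h1 := G.sum_degrees_eq_twice_card_edges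
  have h2 : ∑ x, G.degree x ≤ ∑ _x : V, D := Finset.sum_le_sum fun x _ => by
    rw [← SimpleGraph.card_neighborSet_eq_degree, ← Nat.card_eq_fintype_card,
      Nat.card_coe_set_eq]
    exact hD x
  have h3 : G.edgeSet.ncard = G.edgeFinset.card := by
    rw [← SimpleGraph.coe_edgeFinset, Set.ncard_coe_finset]
  have h4 : G.edgeSet.ncard ≤ D * Nat.card V := by
    rw [Finset.sum_const, Finset.card_univ, smul_eq_mul, mul_comm] at h2
    rw [Nat.card_eq_fintype_card]
    omega
  exact div_le_of_le_mul₀ (by positivity) (by positivity) (by exact_mod_cast h4)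

lemma edgeNum_le_of_eventually {V : ℕ → Type u} {G H : ∀ n, SimpleGraph (V n)}
    (hH : IsGraphSeq V H)
    (h : ∀ᶠ n in atTop, (G n).edgeSet.ncard ≤ (H n).edgeSet.ncard) :
    edgeNum G ≤ edgeNum H := by
  obtain ⟨hfin, ⟨D, hD⟩, -⟩ := hH
  refine liminf_le_liminf ?_ ?_ ?_
  · filter_upwards [h] with n hn
    gcongr
  · exact isBoundedUnder_of ⟨0, fun n => by positivity⟩
  · refine IsBoundedUnder.isCoboundedUnder_ge (isBoundedUnder_of ⟨(D : ℝ), fun n => ?_⟩)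
    have := hfin n
    exact ncard_edgeSet_div_le (hD n)

lemma GEquiv.refl {V : ℕ → Type u} (G : ∀ n, SimpleGraph (V n)) : GEquiv G G :=
  ⟨⟨1, one_pos, fun _ _ _ => by simp⟩, ⟨1, one_pos, fun _ _ _ => by simp⟩⟩

theorem edgeNum_eq_cost_of_largeGirth {V : ℕ → Type u} (G : ∀ n, SimpleGraph (V n))
    (hG : IsGraphSeq V G) (hlg : LargeGirth G) :
    edgeNum G = cost G := by
  symm
  apply IsLeast.csInf_eq
  refine ⟨⟨G, hG, GEquiv.refl G, rfl⟩, ?_⟩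
  rintro _ ⟨H, hH, ⟨⟨L, -, hL⟩, ⟨M, -, hM⟩⟩, rfl⟩
  refine edgeNum_le_of_eventually hH ?_
  obtain ⟨N, hN⟩ := hlg (L * M + 1) (by omega)
  filter_upwards [eventually_ge_atTop N] with n hn
  have := hG.1 n
  exact ncard_edgeSet_le (exists_walk_of_dist_le (hL n) (hM n))
    (exists_walk_of_dist_le (hM n) (hL n)) (hN n hn)

end GraphSeqPaper
end

section
/- Let 𝒢 and ℋ be equivalent graph sequences and K a field. Then β_K(𝒢) = β_K(ℋ). -/
open Filter Function Set
open scoped Classical TensorProduct Pointwise symmDiff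

universe u

namespace GraphSeqPaper

section WalkVectors

variable (K : Type*) [Field K] {V : Type u} {G H : SimpleGraph V}

lemma edgeVec_self {x y : V} : edgeVec K x y x y = 1 := by simp [edgeVec]

lemma edgeVec_swap {x y : V} (h : x ≠ y) : edgeVec K y x = -edgeVec K x y := by
  funext a b
  simp only [edgeVec, Pi.neg_apply]
  by_cases h1 : a = x ∧ b = y
  · rw [if_pos h1, if_pos h1, if_neg fun h2 => h (h1.1.symm.trans h2.1)]
  · by_cases h2 : a = y ∧ b = x
    · rw [if_pos h2, if_neg h1, if_pos h2, neg_neg]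
    · rw [if_neg h2, if_neg h1, if_neg h2, if_neg h1, neg_zero]

lemma edgeVec_comm (x y a b : V) : edgeVec K x y b a = edgeVec K y x a b := by
  simp only [edgeVec, and_comm]

lemma edgeVec_apply_of_ne {x y a b : V} (h : s(x, y) ≠ s(a, b)) : edgeVec K a b x y = 0 := by
  rw [Ne, Sym2.eq_iff] at h
  push Not at h
  simp only [edgeVec]
  rw [if_neg (fun h' => h.1 h'.1 h'.2), if_neg (fun h' => h.2 h'.1 h'.2)]

lemma edgeVec_mem_edgeSpace {x y : V} (h : G.Adj x y) : edgeVec K x y ∈ edgeSpace K G := by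
  refine ⟨fun a b hab => edgeVec_apply_of_ne K fun he => ?_, fun a b => ?_⟩
  · exact hab (by rwa [← SimpleGraph.mem_edgeSet, he, SimpleGraph.mem_edgeSet])
  · rw [edgeVec_comm, edgeVec_swap K h.ne, Pi.neg_apply, Pi.neg_apply]

@[simp] lemma walkVec_nil {x : V} : walkVec K (SimpleGraph.Walk.nil : G.Walk x x) = 0 := rfl

@[simp] lemma walkVec_cons {x y z : V} (h : G.Adj x y) (p : G.Walk y z) :
    walkVec K (SimpleGraph.Walk.cons h p) = edgeVec K x y + walkVec K p := rfl

@[simp] lemma walkVec_append {x y z : V} (p : G.Walk x y) (q : G.Walk y z) :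
    walkVec K (p.append q) = walkVec K p + walkVec K q := by
  induction p with
  | nil => simp
  | cons h p ih => simp [ih, add_assoc]

@[simp] lemma walkVec_reverse {x y : V} (p : G.Walk x y) :
    walkVec K p.reverse = -walkVec K p := by
  induction p with
  | nil => simp
  | cons h p ih => simp [ih, edgeVec_swap K h.ne]

lemma walkVec_mem_edgeSpace {x y : V} (p : G.Walk x y) : walkVec K p ∈ edgeSpace K G := by
  induction p with
  | nil => exact zero_mem _
  | cons h p ih => exact add_mem (edgeVec_mem_edgeSpace K h) ih

lemma cycleSpace_le_edgeSpace (q : ℕ) : cycleSpace K G q ≤ edgeSpace K G := by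
  refine Submodule.span_le.2 ?_
  rintro _ ⟨x, c, -, -, rfl⟩
  exact walkVec_mem_edgeSpace K c

lemma cycleSpace_mono {q r : ℕ} (h : q ≤ r) : cycleSpace K G q ≤ cycleSpace K G r := by
  refine Submodule.span_mono ?_
  rintro _ ⟨x, c, hc, hl, rfl⟩
  exact ⟨x, c, hc, hl.trans h, rfl⟩

lemma walkVec_of_isPath_of_mem_edges {x y : V} (p : G.Walk x y) (hp : p.IsPath)
    (h : s(y, x) ∈ p.edges) : walkVec K p = edgeVec K x y := by
  cases p with
  | nil => simp at h
  | cons hadj p =>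
    rw [SimpleGraph.Walk.cons_isPath_iff] at hp
    rw [SimpleGraph.Walk.edges_cons, List.mem_cons] at h
    rcases h with h | h
    · rw [Sym2.eq_swap, Sym2.congr_right] at h
      subst h
      rw [(SimpleGraph.Walk.isPath_iff_nil.1 hp.1).eq_nil]
      simp
    · exact absurd (p.snd_mem_support_of_mem_edges h) hp.2

lemma walkVec_cons_mem_cycleSpace {x y : V} (h : G.Adj x y) (p : G.Walk y x) (hp : p.IsPath)
    {q : ℕ} (hq : p.length + 1 ≤ q) :
    walkVec K (SimpleGraph.Walk.cons h p) ∈ cycleSpace K G q := by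
  by_cases he : s(x, y) ∈ p.edges
  · rw [walkVec_cons, walkVec_of_isPath_of_mem_edges K p hp he, edgeVec_swap K h.ne,
      add_neg_cancel]
    exact zero_mem _
  · exact Submodule.subset_span
      ⟨x, _, (SimpleGraph.Walk.cons_isCycle_iff p h).2 ⟨hp, he⟩, by simpa using hq, rfl⟩

lemma walkVec_sub_bypass_mem_cycleSpace {x y : V} (p : G.Walk x y) :
    walkVec K p - walkVec K p.bypass ∈ cycleSpace K G p.length := by
  induction p with
  | nil => simp [SimpleGraph.Walk.bypass]
  | @cons u v w h p ih =>
    have ih' := cycleSpace_mono K (Nat.le_succ _) ih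
    have hl := p.length_bypass_le_length
    rw [SimpleGraph.Walk.length_cons, SimpleGraph.Walk.bypass]
    split_ifs with hs
    · have hc := walkVec_cons_mem_cycleSpace K h _ (p.bypass_isPath.takeUntil hs)
        (Nat.succ_le_succ ((p.bypass.length_takeUntil_le_length hs).trans hl))
      have hsplit := congrArg (walkVec K) (p.bypass.take_spec hs)
      rw [walkVec_append] at hsplit
      convert add_mem hc ih' using 1
      rw [walkVec_cons, walkVec_cons, ← hsplit]
      abel
    · simpa using ih'

/-- The vector of a closed walk of length at most `q` is a combination of cycles of length at
most `q`. -/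
lemma walkVec_mem_cycleSpace {x : V} (p : G.Walk x x) {q : ℕ} (hq : p.length ≤ q) :
    walkVec K p ∈ cycleSpace K G q := by
  have h := walkVec_sub_bypass_mem_cycleSpace K p
  rw [(SimpleGraph.Walk.isPath_iff_nil.1 p.bypass_isPath).eq_nil, walkVec_nil, sub_zero] at h
  exact cycleSpace_mono K hq h

end WalkVectors

section Dimension

variable (K : Type*) [Field K] {V : Type u} {G H : SimpleGraph V}

lemma mk_out_edge (e : G.edgeSet) : s((Quot.out e.1).1, (Quot.out e.1).2) = e.1 :=
  Quot.out_eq e.1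

lemma adj_out_edge (e : G.edgeSet) : G.Adj (Quot.out e.1).1 (Quot.out e.1).2 := by
  rw [← SimpleGraph.mem_edgeSet, mk_out_edge]
  exact e.2

lemma sum_edgeVec_out_smul [Fintype G.edgeSet] {W : Type*} [AddCommGroup W] [Module K W]
    {x y : V} (h : G.Adj x y) (w : G.edgeSet → W) :
    ∑ e : G.edgeSet, edgeVec K x y (Quot.out e.1).1 (Quot.out e.1).2 • w e =
      edgeVec K x y (Quot.out s(x, y)).1 (Quot.out s(x, y)).2 • w ⟨s(x, y), h⟩ := by
  refine Finset.sum_eq_single (⟨s(x, y), h⟩ : G.edgeSet) (fun e _ he => ?_) (by simp)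
  rw [edgeVec_apply_of_ne, zero_smul]
  rw [mk_out_edge]
  exact fun h' => he (Subtype.ext h')

lemma out_mk_cases (x y : V) :
    Quot.out s(x, y) = (x, y) ∨ Quot.out s(x, y) = (y, x) := by
  have h : s((Quot.out s(x, y)).1, (Quot.out s(x, y)).2) = s(x, y) := Quot.out_eq _
  rw [Sym2.eq_iff] at h
  simpa [Prod.ext_iff] using h

lemma eq_sum_of_mem_edgeSpace [Fintype G.edgeSet] {f : V → V → K} (hf : f ∈ edgeSpace K G) :
    f = ∑ e : G.edgeSet,
      f (Quot.out e.1).1 (Quot.out e.1).2 • edgeVec K (Quot.out e.1).1 (Quot.out e.1).2 := by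
  funext x y
  simp only [Finset.sum_apply, Pi.smul_apply, smul_eq_mul]
  by_cases h : G.Adj x y
  · rw [Finset.sum_eq_single (⟨s(x, y), h⟩ : G.edgeSet) _ (by simp)]
    · rcases out_mk_cases x y with he | he
      · simp [he, edgeVec_self]
      · simp [he, edgeVec_swap K h.ne, edgeVec_self, hf.2 x y]
    · intro e _ he
      rw [edgeVec_apply_of_ne, mul_zero]
      rw [mk_out_edge]
      exact fun h' => he (Subtype.ext h'.symm)
  · rw [hf.1 x y h, Finset.sum_eq_zero]
    intro e _
    rw [edgeVec_apply_of_ne, mul_zero]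
    rw [mk_out_edge]
    exact fun h' => h (by rw [← SimpleGraph.mem_edgeSet, h']; exact e.2)

lemma finrank_edgeSpace [Finite V] :
    Module.finrank K (edgeSpace K G) = G.edgeSet.ncard := by
  have := Fintype.ofFinite G.edgeSet
  let T : (G.edgeSet → K) →ₗ[K] (V → V → K) :=
    Fintype.linearCombination K fun e : G.edgeSet =>
      edgeVec K (Quot.out e.1).1 (Quot.out e.1).2
  have hT : ∀ g, T g = ∑ e : G.edgeSet, g e • edgeVec K (Quot.out e.1).1 (Quot.out e.1).2 :=
    fun g => Fintype.linearCombination_apply K _ g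
  have hinj : Injective T := by
    refine Function.LeftInverse.injective
      (g := fun f e => f (Quot.out e.1).1 (Quot.out e.1).2) fun g => ?_
    funext e
    rw [hT]
    simp only [Finset.sum_apply, Pi.smul_apply, smul_eq_mul]
    rw [Finset.sum_eq_single e _ (by simp), edgeVec_self, mul_one]
    intro e' _ he
    rw [edgeVec_apply_of_ne, mul_zero]
    rw [mk_out_edge, mk_out_edge]
    exact fun h' => he (Subtype.ext h'.symm)
  have hrange : LinearMap.range T = edgeSpace K G := by
    apply le_antisymm
    · rintro _ ⟨g, rfl⟩
      rw [hT]
      exact sum_mem fun e _ => Submodule.smul_mem _ _ (edgeVec_mem_edgeSpace K (adj_out_edge e))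
    · intro f hf
      exact ⟨_, (hT _).trans (eq_sum_of_mem_edgeSpace K hf).symm⟩
  rw [← hrange, LinearMap.finrank_range_of_inj hinj, Module.finrank_fintype_fun_eq_card,
    ← Nat.card_eq_fintype_card, Nat.card_coe_set_eq]

/-- Replacing each edge of `G` by a walk of `H` of length at most `L` extends to a linear map
on edge vectors. -/
lemma exists_linearMap_edgeVec [Finite V] {L : ℕ}
    (hL : ∀ x y, G.Adj x y → ∃ r : H.Walk x y, r.length ≤ L) :
    ∃ φ : (V → V → K) →ₗ[K] (V → V → K), ∀ x y, G.Adj x y →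
      ∃ r : H.Walk x y, r.length ≤ L ∧ φ (edgeVec K x y) = walkVec K r := by
  have := Fintype.ofFinite G.edgeSet
  choose p hp using fun e : G.edgeSet => hL _ _ (adj_out_edge e)
  let R : (V → V → K) →ₗ[K] (G.edgeSet → K) :=
    LinearMap.pi fun e => LinearMap.proj (R := K) (φ := fun _ : V => K) (Quot.out e.1).2 ∘ₗ
      LinearMap.proj (R := K) (φ := fun _ : V => V → K) (Quot.out e.1).1
  refine ⟨Fintype.linearCombination K (fun e => walkVec K (p e)) ∘ₗ R, fun x y h => ?_⟩
  have hφ : (Fintype.linearCombination K (fun e => walkVec K (p e)) ∘ₗ R) (edgeVec K x y) =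
      ∑ e : G.edgeSet,
        edgeVec K x y (Quot.out e.1).1 (Quot.out e.1).2 • walkVec K (p e) := rfl
  rw [hφ, sum_edgeVec_out_smul K h]
  have hlen := hp ⟨s(x, y), h⟩
  revert hlen
  generalize p ⟨s(x, y), h⟩ = w
  revert w
  rcases out_mk_cases x y with he | he <;> rw [he] <;> intro w hw
  · exact ⟨w, hw, by simp [edgeVec_self]⟩
  · exact ⟨w.reverse, by simpa using hw, by simp [edgeVec_swap K h.ne.symm, edgeVec_self]⟩

lemma exists_walkVec_map {L : ℕ} {φ : (V → V → K) →ₗ[K] (V → V → K)}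
    (hφ : ∀ x y, G.Adj x y →
      ∃ r : H.Walk x y, r.length ≤ L ∧ φ (edgeVec K x y) = walkVec K r)
    {x y : V} (p : G.Walk x y) :
    ∃ r : H.Walk x y, r.length ≤ L * p.length ∧ φ (walkVec K p) = walkVec K r := by
  induction p with
  | nil => exact ⟨.nil, by simp⟩
  | cons h p ih =>
    obtain ⟨r, hr, hr'⟩ := ih
    obtain ⟨s, hs, hs'⟩ := hφ _ _ h
    refine ⟨s.append r, ?_, by simp [hr', hs']⟩
    rw [SimpleGraph.Walk.length_append, SimpleGraph.Walk.length_cons, mul_add, mul_one]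
    omega

lemma finrank_map_add_finrank_inf_ker {W U : Type*} [AddCommGroup W] [Module K W]
    [AddCommGroup U] [Module K U] [FiniteDimensional K W] (f : W →ₗ[K] U) (S : Submodule K W) :
    Module.finrank K (S.map f) + Module.finrank K (S ⊓ LinearMap.ker f : Submodule K W) =
      Module.finrank K S := by
  rw [← LinearMap.finrank_range_add_finrank_ker (f.domRestrict S), LinearMap.range_domRestrict,
    LinearMap.ker_domRestrict, ← Submodule.finrank_map_subtype_eq S, Submodule.map_comap_subtype]

/-- If edges of `G` and `H` can be replaced by boundedly long walks of the other graph, then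
`dim ε(H)/C^r(H) ≤ dim ε(G)/C^q(G)` for all large `r`. -/
lemma finrank_edgeSpace_add_le [Finite V] {L M q r : ℕ}
    (hL : ∀ x y, G.Adj x y → ∃ p : H.Walk x y, p.length ≤ L)
    (hM : ∀ x y, H.Adj x y → ∃ p : G.Walk x y, p.length ≤ M)
    (hr : L * q ≤ r) (hr' : L * M + 1 ≤ r) :
    Module.finrank K (edgeSpace K H) + Module.finrank K (cycleSpace K G q) ≤
      Module.finrank K (edgeSpace K G) + Module.finrank K (cycleSpace K H r) := by
  have := Fintype.ofFinite H.edgeSet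
  obtain ⟨φ, hφ⟩ := exists_linearMap_edgeVec K hL
  have hcyc : (cycleSpace K G q).map φ ≤ cycleSpace K H r := by
    rw [cycleSpace, Submodule.map_span_le]
    rintro _ ⟨x, c, -, hc, rfl⟩
    obtain ⟨p, hp, hp'⟩ := exists_walkVec_map K hφ c
    rw [hp']
    exact walkVec_mem_cycleSpace K p ((hp.trans (Nat.mul_le_mul_left L hc)).trans hr)
  have hedge : edgeSpace K H ≤ (edgeSpace K G).map φ ⊔ cycleSpace K H r := by
    intro f hf
    rw [eq_sum_of_mem_edgeSpace K hf]
    refine sum_mem fun e _ => Submodule.smul_mem _ _ ?_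
    have hadj := adj_out_edge e
    obtain ⟨p, hp⟩ := hM _ _ hadj
    obtain ⟨w, hw, hw'⟩ := exists_walkVec_map K hφ p
    have hc : walkVec K (SimpleGraph.Walk.cons hadj w.reverse) ∈ cycleSpace K H r := by
      refine walkVec_mem_cycleSpace K _ ?_
      have := Nat.mul_le_mul_left L hp
      rw [SimpleGraph.Walk.length_cons, SimpleGraph.Walk.length_reverse]
      omega
    rw [walkVec_cons, walkVec_reverse, ← hw'] at hc
    refine Submodule.mem_sup.2
      ⟨φ (walkVec K p), Submodule.mem_map_of_mem (walkVec_mem_edgeSpace K p), _, hc, ?_⟩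
    abel
  set Q := (cycleSpace K H r).mkQ
  have h1 := finrank_map_add_finrank_inf_ker K Q (edgeSpace K H)
  have h2 := finrank_map_add_finrank_inf_ker K (Q ∘ₗ φ) (edgeSpace K G)
  rw [Submodule.ker_mkQ, inf_eq_right.2 (cycleSpace_le_edgeSpace K r)] at h1
  have h3 : Module.finrank K ((edgeSpace K H).map Q) ≤
      Module.finrank K ((edgeSpace K G).map (Q ∘ₗ φ)) := by
    refine Submodule.finrank_mono ((Submodule.map_mono hedge).trans ?_)
    rw [Submodule.map_sup, Submodule.map_comp, Submodule.mkQ_map_self, sup_bot_eq]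
  have h4 : Module.finrank K (cycleSpace K G q) ≤
      Module.finrank K (edgeSpace K G ⊓ LinearMap.ker (Q ∘ₗ φ) : Submodule K (V → V → K)) := by
    refine Submodule.finrank_mono (le_inf (cycleSpace_le_edgeSpace K q) fun f hf => ?_)
    rw [LinearMap.mem_ker, LinearMap.comp_apply, Submodule.mkQ_apply,
      Submodule.Quotient.mk_eq_zero]
    exact hcyc (Submodule.mem_map_of_mem hf)
  omega

lemma finrank_cycleSpace_le [Finite V] (q : ℕ) :
    Module.finrank K (cycleSpace K G q) ≤ G.edgeSet.ncard := by
  rw [← finrank_edgeSpace K]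
  exact Submodule.finrank_mono (cycleSpace_le_edgeSpace K q)

lemma ncard_edgeSet_le_s1 [Finite V] {D : ℕ} (hD : ∀ x, (G.neighborSet x).ncard ≤ D) :
    G.edgeSet.ncard ≤ D * Nat.card V := by
  have := Fintype.ofFinite V
  have h := G.sum_degrees_eq_twice_card_edges
  have h' : ∑ v, G.degree v ≤ ∑ _v : V, D := by
    refine Finset.sum_le_sum fun v _ => ?_
    rw [← SimpleGraph.card_neighborSet_eq_degree, ← Nat.card_eq_fintype_card,
      Nat.card_coe_set_eq]
    exact hD v
  rw [Finset.sum_const, smul_eq_mul, Finset.card_univ, ← Nat.card_eq_fintype_card,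
    mul_comm] at h'
  rw [← SimpleGraph.coe_edgeFinset, Set.ncard_coe_finset]
  omega

end Dimension

section Sequences

variable (K : Type*) [Field K] {V : ℕ → Type u} {G H : ∀ n, SimpleGraph (V n)}

lemma GEquiv.symm (h : GEquiv G H) : GEquiv H G := ⟨h.2, h.1⟩

lemma GEquiv.exists_walk_length_le (h : GEquiv G H) :
    ∃ L : ℕ, ∀ n x y, (G n).Adj x y → ∃ p : (H n).Walk x y, p.length ≤ L := by
  obtain ⟨⟨M, -, hM⟩, L, -, hL⟩ := h
  refine ⟨L, fun n x y hxy => ?_⟩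
  have hG : (G n).dist x y = 1 := SimpleGraph.dist_eq_one_iff_adj.2 hxy
  have hne : (H n).dist x y ≠ 0 := by
    intro h0
    have := hM n x y
    rw [h0, hG] at this
    omega
  obtain ⟨p, hp⟩ := (SimpleGraph.Reachable.of_dist_ne_zero hne).exists_walk_length_eq_dist
  refine ⟨p, hp.trans_le ((hL n x y).trans ?_)⟩
  rw [hG, mul_one]

lemma edge_sub_cycle_nonneg (hG : IsGraphSeq V G) (q n : ℕ) :
    0 ≤ (((G n).edgeSet.ncard : ℝ) - (Module.finrank K (cycleSpace K (G n) q) : ℝ)) /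
      (Nat.card (V n) : ℝ) := by
  have := hG.1 n
  refine div_nonneg (sub_nonneg.2 ?_) (Nat.cast_nonneg _)
  exact_mod_cast finrank_cycleSpace_le K q

lemma exists_edge_sub_cycle_le (hG : IsGraphSeq V G) (q : ℕ) :
    ∃ D : ℝ, ∀ n,
      (((G n).edgeSet.ncard : ℝ) - (Module.finrank K (cycleSpace K (G n) q) : ℝ)) /
        (Nat.card (V n) : ℝ) ≤ D := by
  obtain ⟨hfin, ⟨D, hD⟩, -⟩ := hG
  refine ⟨D, fun n => ?_⟩
  have := hfin n
  have h : ((G n).edgeSet.ncard : ℝ) ≤ D * Nat.card (V n) := by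
    exact_mod_cast ncard_edgeSet_le_s1 (hD n)
  refine div_le_of_le_mul₀ (Nat.cast_nonneg _) (Nat.cast_nonneg _) (le_trans ?_ h)
  exact sub_le_self _ (Nat.cast_nonneg _)

lemma neg_one_le_sInv (hG : IsGraphSeq V G) (q : ℕ) : -1 ≤ sInv K G q := by
  obtain ⟨D, hD⟩ := exists_edge_sub_cycle_le K hG q
  have h : 0 ≤ liminf (fun n =>
      (((G n).edgeSet.ncard : ℝ) - (Module.finrank K (cycleSpace K (G n) q) : ℝ)) /
        (Nat.card (V n) : ℝ)) atTop :=
    le_liminf_of_le (isBoundedUnder_of ⟨D, hD⟩).isCoboundedUnder_ge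
      (.of_forall (edge_sub_cycle_nonneg K hG q))
  rw [sInv]
  linarith

lemma beta_le_of_gequiv (hG : IsGraphSeq V G) (hH : IsGraphSeq V H) (he : GEquiv G H) :
    beta K H ≤ beta K G := by
  obtain ⟨L, hL⟩ := he.exists_walk_length_le
  obtain ⟨M, hM⟩ := he.symm.exists_walk_length_le
  refine le_ciInf fun q => ?_
  set r := L * q + (L * M + 1)
  refine (ciInf_le ⟨-1, ?_⟩ r).trans ?_
  · rintro _ ⟨q, rfl⟩
    exact neg_one_le_sInv K hH q
  obtain ⟨D, hD⟩ := exists_edge_sub_cycle_le K hG q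
  refine sub_le_sub_right (liminf_le_liminf (.of_forall fun n => ?_)
    (isBoundedUnder_of ⟨0, edge_sub_cycle_nonneg K hH r⟩)
    (isBoundedUnder_of ⟨D, hD⟩).isCoboundedUnder_ge) 1
  have := hG.1 n
  have h := finrank_edgeSpace_add_le K (q := q) (r := r) (hL n) (hM n) (by omega) (by omega)
  rw [finrank_edgeSpace, finrank_edgeSpace] at h
  have h' : ((H n).edgeSet.ncard : ℝ) + Module.finrank K (cycleSpace K (G n) q) ≤
      (G n).edgeSet.ncard + Module.finrank K (cycleSpace K (H n) r) := by exact_mod_cast h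
  refine div_le_div_of_nonneg_right ?_ (Nat.cast_nonneg _)
  linarith

end Sequences

theorem beta_eq_of_gequiv (K : Type*) [Field K] {V : ℕ → Type u}
    (G H : ∀ n, SimpleGraph (V n)) (hG : IsGraphSeq V G) (hH : IsGraphSeq V H)
    (he : GEquiv G H) :
    beta K G = beta K H :=
  le_antisymm (beta_le_of_gequiv K hH hG he.symm) (beta_le_of_gequiv K hG hH he)

end GraphSeqPaper
end

section
/- Let Γ be a finitely generated residually finite group with finite symmetric generating set S, let Γ ⊳ Γ_1 ⊳ Γ_2 ⊳ … be a nested sequence of finite-index normal subgroups with ∩_{n=1}^∞ Γ_n = {1} and [Γ:Γ_n] → ∞, and let 𝒢 = {G_n} be the graph sequence of Cayley graphs of Γ/Γ_n with respect to the image of S. Then for every k ≥ 1, c(𝒢) ≤ d(Γ_k)/[Γ:Γ_k] + 1, where d(Γ_k) is the minimal number of generators of Γ_k. -/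
open Filter Function Set
open scoped Classical TensorProduct Pointwise symmDiff

universe u

namespace GraphSeqPaper

/-- If adjacent vertices of `H` are joined by walks of length at most `L` in `G`, then walks in
`H` can be replaced by walks in `G` that are at most `L` times as long. -/
lemma exists_walk_length_le_mul {V : Type*} {H G : SimpleGraph V} {L : ℕ}
    (h : ∀ x y, H.Adj x y → ∃ p : G.Walk x y, p.length ≤ L) {x y : V} (w : H.Walk x y) :
    ∃ p : G.Walk x y, p.length ≤ L * w.length := by
  induction w with
  | nil => exact ⟨.nil, by simp⟩
  | cons hadj w ih =>
    obtain ⟨p, hp⟩ := h _ _ hadj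
    obtain ⟨q, hq⟩ := ih
    refine ⟨p.append q, ?_⟩
    rw [SimpleGraph.Walk.length_append, SimpleGraph.Walk.length_cons, mul_add]
    omega

lemma prec_of_adj_walk {V : ℕ → Type u} {H G : ∀ n, SimpleGraph (V n)} (L : ℕ)
    (hH : ∀ n, (H n).Preconnected)
    (h : ∀ n x y, (H n).Adj x y → ∃ p : (G n).Walk x y, p.length ≤ L) : Prec H G := by
  refine ⟨L + 1, L.succ_pos, fun n x y => ?_⟩
  obtain ⟨w, hw⟩ := (hH n x y).exists_walk_length_eq_dist
  obtain ⟨p, hp⟩ := exists_walk_length_le_mul (h n) w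
  calc (G n).dist x y ≤ p.length := SimpleGraph.dist_le p
    _ ≤ L * w.length := hp
    _ ≤ (L + 1) * (H n).dist x y := by rw [hw]; gcongr; omega

/-- If each `t ∈ T` moves every point of an invariant set along an edge or not at all, then each
element of the subgroup generated by `T` moves every point along a walk of bounded length,
uniformly over the family of graphs. -/
lemma exists_walk_smul_of_mem_closure {Γ ι : Type*} [Group Γ] {V : ι → Type*}
    [∀ i, MulAction Γ (V i)] (G : ∀ i, SimpleGraph (V i)) (A : ∀ i, Set (V i)) (T : Set Γ)
    (hA : ∀ g ∈ Subgroup.closure T, ∀ i, ∀ x ∈ A i, g • x ∈ A i)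
    (hT : ∀ t ∈ T, ∀ i, ∀ x ∈ A i, x ≠ t • x → (G i).Adj x (t • x))
    {g : Γ} (hg : g ∈ Subgroup.closure T) :
    ∃ C : ℕ, ∀ i, ∀ x ∈ A i, ∃ p : (G i).Walk x (g • x), p.length ≤ C := by
  induction hg using Subgroup.closure_induction with
  | mem t ht =>
    refine ⟨1, fun i x hx => ?_⟩
    by_cases hxt : x = t • x
    · exact ⟨SimpleGraph.Walk.nil.copy rfl hxt, by simp⟩
    · exact ⟨(hT t ht i x hx hxt).toWalk, by simp⟩
  | one => exact ⟨0, fun i x _ => ⟨SimpleGraph.Walk.nil.copy rfl (one_smul Γ x).symm, by simp⟩⟩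
  | mul a b ha hb iha ihb =>
    obtain ⟨C, hC⟩ := iha
    obtain ⟨D, hD⟩ := ihb
    refine ⟨C + D, fun i x hx => ?_⟩
    obtain ⟨p, hp⟩ := hD i x hx
    obtain ⟨q, hq⟩ := hC i (b • x) (hA b hb i x hx)
    refine ⟨(p.append q).copy rfl (mul_smul a b x).symm, ?_⟩
    rw [SimpleGraph.Walk.length_copy, SimpleGraph.Walk.length_append]
    omega
  | inv a ha iha =>
    obtain ⟨C, hC⟩ := iha
    refine ⟨C, fun i x hx => ?_⟩
    obtain ⟨p, hp⟩ := hC i (a⁻¹ • x) (hA a⁻¹ (inv_mem ha) i x hx)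
    exact ⟨(p.copy rfl (smul_inv_smul a x)).reverse, by simpa using hp⟩

/-- The bound of `exists_walk_smul_of_mem_closure` can be chosen uniformly over a finite set of
group elements. -/
lemma exists_walk_smul_of_finite_subset_closure {Γ ι : Type*} [Group Γ] {V : ι → Type*}
    [∀ i, MulAction Γ (V i)] (G : ∀ i, SimpleGraph (V i)) (A : ∀ i, Set (V i)) (T : Set Γ)
    (hA : ∀ g ∈ Subgroup.closure T, ∀ i, ∀ x ∈ A i, g • x ∈ A i)
    (hT : ∀ t ∈ T, ∀ i, ∀ x ∈ A i, x ≠ t • x → (G i).Adj x (t • x))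
    {E : Set Γ} (hE : E.Finite) (hET : E ⊆ Subgroup.closure T) :
    ∃ C : ℕ, ∀ g ∈ E, ∀ i, ∀ x ∈ A i, ∃ p : (G i).Walk x (g • x), p.length ≤ C := by
  choose! C hC using fun g (hg : g ∈ Subgroup.closure T) =>
    exists_walk_smul_of_mem_closure G A T hA hT hg
  obtain ⟨B, hB⟩ := (hE.image C).bddAbove
  refine ⟨B, fun g hg i x hx => ?_⟩
  obtain ⟨p, hp⟩ := hC g (hET hg) i x hx
  exact ⟨p, hp.trans (hB (mem_image_of_mem C hg))⟩

lemma cayleyQuot_adj {Γ : Type u} [Group Γ] {N : Subgroup Γ} (hN : N.Normal) {S : Set Γ}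
    {x y : Γ ⧸ N} : (cayleyQuot N hN S).Adj x y ↔
      x ≠ y ∧ ((∃ s ∈ S, y = s • x) ∨ ∃ s ∈ S, x = s • y) := by
  have key : ∀ a b : Γ ⧸ N,
      b * a⁻¹ ∈ (fun g => (QuotientGroup.mk g : Γ ⧸ N)) '' S ↔ ∃ s ∈ S, b = s • a := by
    intro a b
    have hsmul : ∀ s : Γ, s • a = (QuotientGroup.mk s : Γ ⧸ N) * a := fun s => by
      induction a using QuotientGroup.induction_on
      rfl
    simp only [mem_image, hsmul, ← mul_inv_eq_iff_eq_mul, eq_comm]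
  rw [cayleyQuot, cayley, SimpleGraph.fromRel_adj]
  exact and_congr_right fun _ => or_congr (key x y) (key y x)

/-- The element of `M` obtained from `g` by dividing by the chosen representative of `g M`. -/
noncomputable def cosetProj {Γ : Type*} [Group Γ] (M : Subgroup Γ) (g : Γ) : Γ :=
  (QuotientGroup.mk g : Γ ⧸ M).out⁻¹ * g

lemma cosetProj_mem {Γ : Type*} [Group Γ] (M : Subgroup Γ) (g : Γ) : cosetProj M g ∈ M := by
  rw [cosetProj, ← QuotientGroup.eq, QuotientGroup.out_eq']

/-- The graph on `Γ ⧸ N` in which the image of `M` carries the edges `x ~ t x` for `t ∈ T` and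
every vertex is joined to its projection to the image of `M`. -/
noncomputable def cosetStarGraph {Γ : Type u} [Group Γ] (M : Subgroup Γ) (T : Set Γ)
    (N : Subgroup Γ) : SimpleGraph (Γ ⧸ N) :=
  SimpleGraph.fromRel fun x y =>
    (x ∈ (QuotientGroup.mk '' (M : Set Γ) : Set (Γ ⧸ N)) ∧ ∃ t ∈ T, y = t • x) ∨
      ∃ g : Γ, x = QuotientGroup.mk g ∧ y = QuotientGroup.mk (cosetProj M g)

section cosetStarGraph

variable {Γ : Type u} [Group Γ] {M : Subgroup Γ} {T : Set Γ}

/-- Adjacent vertices of `cosetStarGraph M T N` differ by an element of a finite set which does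
not depend on `N`. -/
lemma exists_finite_cosetStarGraph_adj (M : Subgroup Γ) [M.FiniteIndex] (hT : T.Finite) :
    ∃ E : Set Γ, E.Finite ∧
      ∀ N, ∀ x y : Γ ⧸ N, (cosetStarGraph M T N).Adj x y → ∃ e ∈ E, y = e • x := by
  let R : Set Γ := T ∪ range fun q : Γ ⧸ M => q.out⁻¹
  have hR : R.Finite := hT.union (finite_range _)
  have key : ∀ N, ∀ x y : Γ ⧸ N,
      ((x ∈ (QuotientGroup.mk '' (M : Set Γ) : Set (Γ ⧸ N)) ∧ ∃ t ∈ T, y = t • x) ∨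
        ∃ g : Γ, x = QuotientGroup.mk g ∧ y = QuotientGroup.mk (cosetProj M g)) →
      ∃ e ∈ R, y = e • x := by
    rintro N x y (⟨-, t, ht, rfl⟩ | ⟨g, rfl, rfl⟩)
    · exact ⟨t, Or.inl ht, rfl⟩
    · exact ⟨_, Or.inr ⟨QuotientGroup.mk g, rfl⟩, rfl⟩
  refine ⟨R ∪ R⁻¹, hR.union hR.inv, fun N x y hxy => ?_⟩
  rw [cosetStarGraph, SimpleGraph.fromRel_adj] at hxy
  rcases hxy.2 with h | h
  · obtain ⟨e, he, rfl⟩ := key N x y h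
    exact ⟨e, Or.inl he, rfl⟩
  · obtain ⟨e, he, rfl⟩ := key N y x h
    exact ⟨e⁻¹, Or.inr (by simpa using he), (inv_smul_smul e y).symm⟩

lemma exists_walk_cosetProj (N : Subgroup Γ) (g : Γ) :
    ∃ p : (cosetStarGraph M T N).Walk (QuotientGroup.mk g) (QuotientGroup.mk (cosetProj M g)),
      p.length ≤ 1 := by
  by_cases h : (QuotientGroup.mk g : Γ ⧸ N) = QuotientGroup.mk (cosetProj M g)
  · exact ⟨SimpleGraph.Walk.nil.copy rfl h, by simp⟩
  · have hadj : (cosetStarGraph M T N).Adj (QuotientGroup.mk g)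
        (QuotientGroup.mk (cosetProj M g)) := by
      rw [cosetStarGraph, SimpleGraph.fromRel_adj]
      exact ⟨h, Or.inl (Or.inr ⟨g, rfl, rfl⟩)⟩
    exact ⟨hadj.toWalk, by simp⟩

/-- Translation by an element of a finite set `S` is realised by walks of uniformly bounded length
in the graphs `cosetStarGraph M T N`. -/
lemma exists_cosetStarGraph_walk_smul (M : Subgroup Γ) [M.FiniteIndex]
    (hTM : Subgroup.closure T = M) {S : Set Γ} (hS : S.Finite) :
    ∃ L : ℕ, ∀ s ∈ S, ∀ (N : Subgroup Γ) (x : Γ ⧸ N),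
      ∃ p : (cosetStarGraph M T N).Walk x (s • x), p.length ≤ L := by
  let E : Set Γ := (fun q : (Γ ⧸ M) × Γ × (Γ ⧸ M) => q.1.out⁻¹ * q.2.1 * q.2.2.out) ''
    (univ ×ˢ S ×ˢ univ)
  have hE : E.Finite := (finite_univ.prod (hS.prod finite_univ)).image _
  obtain ⟨C, hC⟩ := exists_walk_smul_of_finite_subset_closure (fun N => cosetStarGraph M T N)
    (fun N => (QuotientGroup.mk '' (M : Set Γ) : Set (Γ ⧸ N))) T
    (by
      rintro g hg N _ ⟨m, hm, rfl⟩
      exact ⟨g * m, M.mul_mem (hTM ▸ hg) hm, rfl⟩)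
    (by
      intro t ht N x hx hne
      rw [cosetStarGraph, SimpleGraph.fromRel_adj]
      exact ⟨hne, Or.inl (Or.inl ⟨hx, t, ht, rfl⟩)⟩)
    (hE.subset inter_subset_left) (inter_subset_right (s := E))
  refine ⟨C + 2, fun s hs N x => ?_⟩
  induction x using QuotientGroup.induction_on with | _ g
  have hmul : cosetProj M (s * g) * (cosetProj M g)⁻¹ ∈ E ∩ Subgroup.closure T := by
    refine ⟨⟨(QuotientGroup.mk (s * g), s, QuotientGroup.mk g),
      ⟨mem_univ _, hs, mem_univ _⟩, ?_⟩, ?_⟩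
    · simp only [cosetProj]
      group
    · rw [hTM]
      exact M.mul_mem (cosetProj_mem M _) (M.inv_mem (cosetProj_mem M g))
  obtain ⟨p, hp⟩ := exists_walk_cosetProj (M := M) (T := T) N g
  obtain ⟨q, hq⟩ := hC _ hmul N (QuotientGroup.mk (cosetProj M g))
    (mem_image_of_mem _ (cosetProj_mem M g))
  obtain ⟨r, hr⟩ := exists_walk_cosetProj (M := M) (T := T) N (s * g)
  have hend : (cosetProj M (s * g) * (cosetProj M g)⁻¹) •
      (QuotientGroup.mk (cosetProj M g) : Γ ⧸ N) = QuotientGroup.mk (cosetProj M (s * g)) := by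
    rw [MulAction.Quotient.smul_mk, smul_eq_mul, inv_mul_cancel_right]
  refine ⟨((p.append (q.copy rfl hend)).append r.reverse).copy rfl
    (MulAction.Quotient.smul_mk N s g).symm, ?_⟩
  simp only [SimpleGraph.Walk.length_append, SimpleGraph.Walk.length_copy,
    SimpleGraph.Walk.length_reverse]
  omega

lemma ncard_edgeSet_cosetStarGraph_le (hT : T.Finite) {N : Subgroup Γ} [N.FiniteIndex]
    (hNM : N ≤ M) : (cosetStarGraph M T N).edgeSet.ncard ≤
      T.ncard * (QuotientGroup.mk '' (M : Set Γ) : Set (Γ ⧸ N)).ncard + Nat.card (Γ ⧸ N) := by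
  set A : Set (Γ ⧸ N) := QuotientGroup.mk '' (M : Set Γ) with hA
  let f : Γ × (Γ ⧸ N) → Sym2 (Γ ⧸ N) := fun p => s(p.2, p.1 • p.2)
  let e : Γ ⧸ N → Sym2 (Γ ⧸ N) := fun x => s(x, QuotientGroup.mk (cosetProj M x.out))
  have key : ∀ x y : Γ ⧸ N, (x ∈ A ∧ ∃ t ∈ T, y = t • x) ∨
      (∃ g : Γ, x = QuotientGroup.mk g ∧ y = QuotientGroup.mk (cosetProj M g)) →
      s(x, y) ∈ f '' (T ×ˢ A) ∪ e '' univ := by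
    rintro x y (⟨hx, t, ht, rfl⟩ | ⟨g, rfl, rfl⟩)
    · exact Or.inl ⟨(t, x), ⟨ht, hx⟩, rfl⟩
    · refine Or.inr ⟨QuotientGroup.mk g, mem_univ _, ?_⟩
      have hout : (QuotientGroup.mk (QuotientGroup.mk g : Γ ⧸ N).out : Γ ⧸ N) =
          QuotientGroup.mk g := QuotientGroup.out_eq' _
      have hM : (QuotientGroup.mk (QuotientGroup.mk g : Γ ⧸ N).out : Γ ⧸ M) =
          QuotientGroup.mk g := QuotientGroup.eq.2 (hNM (QuotientGroup.eq.1 hout))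
      simp only [e, cosetProj, hM, ← smul_eq_mul, ← MulAction.Quotient.smul_mk, hout]
  have hsub : (cosetStarGraph M T N).edgeSet ⊆ f '' (T ×ˢ A) ∪ e '' univ := by
    intro z hz
    induction z using Sym2.ind with | _ x y
    rw [SimpleGraph.mem_edgeSet, cosetStarGraph, SimpleGraph.fromRel_adj] at hz
    rcases hz.2 with h | h
    · exact key x y h
    · rw [Sym2.eq_swap]
      exact key y x h
  have hTA : (T ×ˢ A).Finite := hT.prod (toFinite A)
  calc (cosetStarGraph M T N).edgeSet.ncard
      ≤ (f '' (T ×ˢ A) ∪ e '' univ).ncard := ncard_le_ncard hsub (toFinite _)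
    _ ≤ (f '' (T ×ˢ A)).ncard + (e '' univ).ncard := ncard_union_le _ _
    _ ≤ (T ×ˢ A).ncard + (univ : Set (Γ ⧸ N)).ncard :=
      add_le_add (ncard_image_le hTA) (ncard_image_le finite_univ)
    _ = _ := by rw [ncard_prod, ncard_univ]

end cosetStarGraph

lemma ncard_image_mk_mul_index {Γ : Type*} [Group Γ] {M N : Subgroup Γ} [N.Normal]
    (hNM : N ≤ M) :
    (QuotientGroup.mk '' (M : Set Γ) : Set (Γ ⧸ N)).ncard * M.index = N.index := by
  have hidx : (M.map (QuotientGroup.mk' N)).index = M.index :=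
    Subgroup.index_map_eq M (QuotientGroup.mk'_surjective N) (by rwa [QuotientGroup.ker_mk'])
  have hcard := (M.map (QuotientGroup.mk' N)).card_mul_index
  rw [hidx] at hcard
  exact hcard

lemma exists_finite_closure_eq_ncard_eq_minGens {Γ : Type u} [Group Γ] (M : Subgroup Γ)
    [Group.FG M] :
    ∃ T : Set Γ, T.Finite ∧ T.ncard = minGens M ∧ Subgroup.closure T = M := by
  have hne : {d : ℕ | ∃ T : Set M, T.Finite ∧ T.ncard = d ∧ Subgroup.closure T = ⊤}.Nonempty := by
    obtain ⟨T, hT, hfin⟩ := Group.fg_iff.1 ‹Group.FG M›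
    exact ⟨_, T, hfin, rfl, hT⟩
  obtain ⟨T, hfin, hcard, hT⟩ := Nat.sInf_mem hne
  refine ⟨M.subtype '' T, hfin.image _, ?_, ?_⟩
  · rw [ncard_image_of_injective _ M.subtype_injective, hcard, minGens]
  · rw [← MonoidHom.map_closure, hT, ← MonoidHom.range_eq_map, Subgroup.range_subtype]

lemma edgeNum_nonneg {V : ℕ → Type u} (H : ∀ n, SimpleGraph (V n)) : 0 ≤ edgeNum H := by
  rw [edgeNum, liminf_eq]
  exact Real.sSup_nonneg' ⟨0, Eventually.of_forall fun _ => by positivity, le_rfl⟩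

lemma cost_le_edgeNum {V : ℕ → Type u} {G H : ∀ n, SimpleGraph (V n)} (hH : IsGraphSeq V H)
    (h : GEquiv G H) : cost G ≤ edgeNum H :=
  csInf_le ⟨0, by rintro _ ⟨H', -, -, rfl⟩; exact edgeNum_nonneg H'⟩ ⟨H, hH, h, rfl⟩

lemma edgeNum_le_of_eventually_le {V : ℕ → Type u} {H : ∀ n, SimpleGraph (V n)} {B : ℝ}
    (h : ∀ᶠ n in atTop, ((H n).edgeSet.ncard : ℝ) / (Nat.card (V n) : ℝ) ≤ B) :
    edgeNum H ≤ B := by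
  rw [edgeNum, liminf_eq]
  refine csSup_le ⟨0, Eventually.of_forall fun _ => by positivity⟩ fun a ha => ?_
  obtain ⟨n, hn, hn'⟩ := (ha.and h).exists
  exact hn.trans hn'

theorem cost_le_minGens_div_index_add_one {Γ : Type u} [Group Γ] (S : Set Γ)
    (hSfin : S.Finite) (hSsym : ∀ s ∈ S, s⁻¹ ∈ S) (hSgen : Subgroup.closure S = ⊤)
    (N : ℕ → Subgroup Γ) (hnorm : ∀ n, (N n).Normal)
    (hnested : ∀ n, N (n + 1) ≤ N n) (hfi : ∀ n, (N n).FiniteIndex)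
    (hinter : ⨅ n, N n = ⊥)
    (hidx : Tendsto (fun n => (N n).index) atTop atTop) :
    ∀ k : ℕ, cost (fun n => cayleyQuot (N n) (hnorm n) S) ≤
      (minGens ↥(N k) : ℝ) / ((N k).index : ℝ) + 1 := by
  intro k
  have : Group.FG Γ := Group.fg_iff.2 ⟨S, hSgen, hSfin⟩
  have := hfi
  obtain ⟨T, hTfin, hTcard, hTM⟩ := exists_finite_closure_eq_ncard_eq_minGens (N k)
  obtain ⟨E, hEfin, hE⟩ := exists_finite_cosetStarGraph_adj (N k) hTfin
  obtain ⟨L, hL⟩ := exists_cosetStarGraph_walk_smul (N k) hTM hSfin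
  have hwalkG : ∀ {F : Set Γ}, F.Finite → ∃ C : ℕ, ∀ g ∈ F, ∀ n, ∀ x ∈ (univ : Set (Γ ⧸ N n)),
      ∃ p : (cayleyQuot (N n) (hnorm n) S).Walk x (g • x), p.length ≤ C := fun hF =>
    exists_walk_smul_of_finite_subset_closure (fun n => cayleyQuot (N n) (hnorm n) S)
      (fun _ => univ) S (fun _ _ _ _ _ => mem_univ _)
      (fun s hs n x _ hne => (cayleyQuot_adj (hnorm n)).2 ⟨hne, Or.inl ⟨s, hs, rfl⟩⟩) hF
      (fun g _ => by rw [hSgen]; exact Subgroup.mem_top g)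
  have hpreG : ∀ n, (cayleyQuot (N n) (hnorm n) S).Preconnected := by
    intro n x y
    obtain ⟨g, rfl⟩ := MulAction.exists_smul_eq Γ x y
    obtain ⟨C, hC⟩ := hwalkG (finite_singleton g)
    obtain ⟨p, -⟩ := hC g rfl n x (mem_univ x)
    exact ⟨p⟩
  have hadjG : ∀ n x y, (cayleyQuot (N n) (hnorm n) S).Adj x y →
      ∃ p : (cosetStarGraph (N k) T (N n)).Walk x y, p.length ≤ L := by
    intro n x y hxy
    rcases ((cayleyQuot_adj (hnorm n)).1 hxy).2 with ⟨s, hs, rfl⟩ | ⟨s, hs, rfl⟩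
    · exact hL s hs (N n) x
    · obtain ⟨p, hp⟩ := hL s hs (N n) y
      exact ⟨p.reverse, by rwa [SimpleGraph.Walk.length_reverse]⟩
  have hpreH : ∀ n, (cosetStarGraph (N k) T (N n)).Preconnected := by
    intro n x y
    obtain ⟨w⟩ := hpreG n x y
    obtain ⟨p, -⟩ := exists_walk_length_le_mul (hadjG n) w
    exact ⟨p⟩
  obtain ⟨C, hC⟩ := hwalkG hEfin
  have hequiv : GEquiv (fun n => cayleyQuot (N n) (hnorm n) S)
      (fun n => cosetStarGraph (N k) T (N n)) := by
    refine ⟨prec_of_adj_walk C hpreH fun n x y hxy => ?_, prec_of_adj_walk L hpreG hadjG⟩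
    obtain ⟨e, he, rfl⟩ := hE (N n) x y hxy
    exact hC e he n x (mem_univ x)
  have hseq : IsGraphSeq (fun n => Γ ⧸ N n) (fun n => cosetStarGraph (N k) T (N n)) := by
    refine ⟨fun n => inferInstance, ⟨E.ncard, fun n x => ?_⟩, hidx⟩
    have hsub : (cosetStarGraph (N k) T (N n)).neighborSet x ⊆ (fun e : Γ => e • x) '' E := by
      intro y hy
      obtain ⟨e, he, rfl⟩ := hE (N n) x y hy
      exact ⟨e, he, rfl⟩
    exact (ncard_le_ncard hsub (hEfin.image _)).trans (ncard_image_le hEfin)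
  refine (cost_le_edgeNum hseq hequiv).trans (edgeNum_le_of_eventually_le ?_)
  filter_upwards [eventually_ge_atTop k] with n hn
  have hle : N n ≤ N k := antitone_nat_of_succ_le hnested hn
  have := hnorm n
  have hcount := ncard_edgeSet_cosetStarGraph_le hTfin hle
  have hcard : _ = Nat.card (Γ ⧸ N n) := ncard_image_mk_mul_index hle
  have hk : (0 : ℝ) < (N k).index := by exact_mod_cast Nat.pos_of_ne_zero (hfi k).index_ne_zero
  have hV : (0 : ℝ) < Nat.card (Γ ⧸ N n) := by exact_mod_cast Nat.card_pos
  rw [hTcard] at hcount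
  rw [div_le_iff₀ hV]
  have hcount' := (Nat.cast_le (α := ℝ)).2 hcount
  have hcard' := congrArg (Nat.cast (R := ℝ)) hcard
  push_cast at hcount' hcard'
  refine hcount'.trans_eq ?_
  rw [← hcard']
  field_simp

end GraphSeqPaper
end
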